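/- Let m ≥ 3 be an integer and for 1 ≤ i ≤ m let u_i : ℝ^m ∖ {0} → ℝ be given by u_i(x) = x_i·|x|^{−2} (the components of the inversion φ(x) = x/|x|²). Then: (1) Δ(|x|⁴·Δu_i) = 0 identically on ℝ^m ∖ {0} for every i, so the inversion is f-biharmonic for f(x) = |x|⁴; (2) Δu_i(x) = 2(2 − m)·x_i·|x|^{−4}, which is not identically zero, so the inversion is not harmonic; (3) if moreover m ≠ 4, then Δ(Δu_i) is not identically zero on ℝ^m ∖ {0}, so the inversion is not biharmonic, and in addition Δ(|x|^{4−m}·Δu_i) = 0 identically on ℝ^m ∖ {0}, so the inversion is also f-biharmonic for f(x) = |x|^{4−m}. -/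

import Mathlib

/-- The Euclidean Laplacian `Δu = ∑ i ∂²u/∂x_i²` of a function on `ℝ^m`. -/
noncomputable def eLaplacian {m : ℕ} (u : EuclideanSpace ℝ (Fin m) → ℝ)
    (x : EuclideanSpace ℝ (Fin m)) : ℝ :=
  ∑ i : Fin m,
    fderiv ℝ (fun y => fderiv ℝ u y (EuclideanSpace.single i 1)) x (EuclideanSpace.single i 1)

/-- The derivative of `‖x‖ ^ a` away from the origin. -/
theorem hasFDerivAt_norm_rpow_of_ne_zero {E : Type*} [NormedAddCommGroup E]
    [InnerProductSpace ℝ E] (a : ℝ) {x : E} (hx : x ≠ 0) :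
    HasFDerivAt (fun y : E => ‖y‖ ^ a) ((a * ‖x‖ ^ (a - 2)) • innerSL ℝ x) x := by
  have hpos : 0 < ‖x‖ := norm_pos_iff.mpr hx
  have hsq (b : ℝ) (y : E) : (‖y‖ ^ 2) ^ (b / 2) = ‖y‖ ^ b := by
    rw [← Real.rpow_natCast_mul (norm_nonneg y)]
    congr 1
    push_cast
    ring
  have h := (hasStrictFDerivAt_norm_sq x).hasFDerivAt.rpow_const (p := a / 2)
    (Or.inl (by positivity))
  simp only [hsq] at h
  convert h using 1
  rw [show a / 2 - 1 = (a - 2) / 2 by ring, hsq, ← Nat.cast_smul_eq_nsmul ℝ, smul_smul]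
  congr 1
  push_cast
  ring

/-- Away from the origin, `Δ (c * x i * ‖x‖ ^ a) = c * a * (a + m) * x i * ‖x‖ ^ (a - 2)`; only
the values of the function away from the origin matter. -/
theorem eLaplacian_coord_mul_norm_rpow {m : ℕ} (i : Fin m) (a c : ℝ)
    {f : EuclideanSpace ℝ (Fin m) → ℝ} (hf : ∀ y ≠ 0, f y = c * (y i * ‖y‖ ^ a))
    {x : EuclideanSpace ℝ (Fin m)} (hx : x ≠ 0) :
    eLaplacian f x = c * (a * (a + m) * (x i * ‖x‖ ^ (a - 2))) := by
  have hcoord (j : Fin m) (y : EuclideanSpace ℝ (Fin m)) :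
      HasFDerivAt (fun y : EuclideanSpace ℝ (Fin m) => y j)
        (EuclideanSpace.proj j : EuclideanSpace ℝ (Fin m) →L[ℝ] ℝ) y :=
    (EuclideanSpace.proj j : EuclideanSpace ℝ (Fin m) →L[ℝ] ℝ).hasFDerivAt
  have hfirst (j : Fin m) (y : EuclideanSpace ℝ (Fin m)) (hy : y ≠ 0) :
      fderiv ℝ f y (EuclideanSpace.single j 1) =
        c * ((if i = j then 1 else 0) * ‖y‖ ^ a + a * (y i * (y j * ‖y‖ ^ (a - 2)))) := by
    have heq : f =ᶠ[nhds y] fun z => c * (z i * ‖z‖ ^ a) := by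
      filter_upwards [isOpen_ne.mem_nhds hy] with z hz using hf z hz
    have hderiv := ((hcoord i y).mul (hasFDerivAt_norm_rpow_of_ne_zero a hy)).const_mul c
    rw [heq.fderiv_eq]
    refine (congrArg (fun L => L (EuclideanSpace.single j 1)) hderiv.fderiv).trans ?_
    by_cases hij : i = j
    · subst hij
      simp [EuclideanSpace.inner_single_right]
      ring
    · simp [EuclideanSpace.inner_single_right, hij]
      exact Or.inl (by ring)
  have hsecond (j : Fin m) :
      fderiv ℝ (fun y => fderiv ℝ f y (EuclideanSpace.single j 1)) x
          (EuclideanSpace.single j 1) =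
        c * ((if i = j then 2 * a * (x j * ‖x‖ ^ (a - 2)) else 0) + a * x i * ‖x‖ ^ (a - 2) +
          a * (a - 2) * x i * ‖x‖ ^ (a - 2 - 2) * x j ^ 2) := by
    have heq : (fun y => fderiv ℝ f y (EuclideanSpace.single j 1)) =ᶠ[nhds x] fun y =>
        c * ((if i = j then 1 else 0) * ‖y‖ ^ a + a * (y i * (y j * ‖y‖ ^ (a - 2)))) := by
      filter_upwards [isOpen_ne.mem_nhds hx] with z hz using hfirst j z hz
    have hderiv := ((((hasFDerivAt_norm_rpow_of_ne_zero a hx).const_mul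
      (if i = j then 1 else 0)).add (((hcoord i x).mul ((hcoord j x).mul
        (hasFDerivAt_norm_rpow_of_ne_zero (a - 2) hx))).const_mul a)).const_mul c)
    rw [heq.fderiv_eq]
    refine (congrArg (fun L => L (EuclideanSpace.single j 1)) hderiv.fderiv).trans ?_
    by_cases hij : i = j
    · subst hij
      simp [EuclideanSpace.inner_single_right]
      ring
    · simp [EuclideanSpace.inner_single_right, hij]
      ring
  have hnorm : ‖x‖ ^ (a - 2 - 2) * ∑ j, x j ^ 2 = ‖x‖ ^ (a - 2) := by
    rw [← EuclideanSpace.real_norm_sq_eq, ← Real.rpow_natCast,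
      ← Real.rpow_add (norm_pos_iff.mpr hx)]
    congr 1
    push_cast
    ring
  simp only [eLaplacian, hsecond, ← Finset.mul_sum, Finset.sum_add_distrib, Finset.sum_ite_eq,
    Finset.mem_univ, if_true, Finset.sum_const, Finset.card_univ, Fintype.card_fin, nsmul_eq_mul]
  linear_combination c * a * (a - 2) * x i * hnorm

/-- For `m ≥ 3`, the inversion `φ(x) = x/|x|²`, with components `u_i(x) = x_i·|x|^{−2}`:
(1) is `f`-biharmonic for `f(x) = |x|⁴`; (2) has `Δu_i(x) = 2(2 − m)·x_i·|x|^{−4}` not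
identically zero, so it is not harmonic; (3) if `m ≠ 4` it is not biharmonic, and it is
also `f`-biharmonic for `f(x) = |x|^{4−m}`. -/
theorem stmt_9 (m : ℕ) (hm : 3 ≤ m)
    (u : Fin m → EuclideanSpace ℝ (Fin m) → ℝ)
    (hu : ∀ i : Fin m, u i = fun x => x i * ‖x‖ ^ (-2 : ℝ)) :
    (∀ i : Fin m, ∀ x : EuclideanSpace ℝ (Fin m), x ≠ 0 →
        eLaplacian (fun y => ‖y‖ ^ (4 : ℝ) * eLaplacian (u i) y) x = 0) ∧
    ((∀ i : Fin m, ∀ x : EuclideanSpace ℝ (Fin m), x ≠ 0 →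
        eLaplacian (u i) x = 2 * (2 - (m : ℝ)) * x i * ‖x‖ ^ (-4 : ℝ)) ∧
      ¬ (∀ i : Fin m, ∀ x : EuclideanSpace ℝ (Fin m), x ≠ 0 → eLaplacian (u i) x = 0)) ∧
    (m ≠ 4 →
      (¬ (∀ i : Fin m, ∀ x : EuclideanSpace ℝ (Fin m), x ≠ 0 →
            eLaplacian (eLaplacian (u i)) x = 0)) ∧
      (∀ i : Fin m, ∀ x : EuclideanSpace ℝ (Fin m), x ≠ 0 →
          eLaplacian (fun y => ‖y‖ ^ ((4 : ℝ) - (m : ℝ)) * eLaplacian (u i) y) x = 0)) := by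
  have hlap (i : Fin m) (x : EuclideanSpace ℝ (Fin m)) (hx : x ≠ 0) :
      eLaplacian (u i) x = 2 * (2 - (m : ℝ)) * (x i * ‖x‖ ^ (-4 : ℝ)) := by
    rw [eLaplacian_coord_mul_norm_rpow i (-2) 1 (fun y _ => by rw [hu, one_mul]) hx,
      show (-2 : ℝ) - 2 = -4 by norm_num]
    ring
  have hweight (b : ℝ) (i : Fin m) (y : EuclideanSpace ℝ (Fin m)) (hy : y ≠ 0) :
      ‖y‖ ^ b * eLaplacian (u i) y = 2 * (2 - (m : ℝ)) * (y i * ‖y‖ ^ (b + -4)) := by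
    rw [hlap i y hy, Real.rpow_add (norm_pos_iff.mpr hy)]
    ring
  have hm2 : (2 - (m : ℝ)) ≠ 0 := by
    have : (3 : ℝ) ≤ m := by exact_mod_cast hm
    linarith
  let i₀ : Fin m := ⟨0, by omega⟩
  let e : EuclideanSpace ℝ (Fin m) := EuclideanSpace.single i₀ 1
  have henorm : ‖e‖ = 1 := by simp [e]
  have hei : e i₀ = 1 := by simp [e]
  have he : e ≠ 0 := norm_ne_zero_iff.mp (by rw [henorm]; exact one_ne_zero)
  refine ⟨fun i x hx => ?_, ⟨fun i x hx => by rw [hlap i x hx]; ring, fun h => ?_⟩,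
    fun hm4 => ⟨fun h => ?_, fun i x hx => ?_⟩⟩
  · rw [eLaplacian_coord_mul_norm_rpow i _ _ (hweight 4 i) hx]
    ring
  · have h₀ := h i₀ e he
    rw [hlap i₀ e he, henorm, hei, Real.one_rpow] at h₀
    exact hm2 (by linarith)
  · have h₀ := h i₀ e he
    rw [eLaplacian_coord_mul_norm_rpow i₀ _ _ (hlap i₀) he, henorm, hei, Real.one_rpow] at h₀
    have hm4' : (-4 + (m : ℝ)) ≠ 0 := fun h => hm4 (by exact_mod_cast (by linarith : (m : ℝ) = 4))
    exact mul_ne_zero hm2 hm4' (by linarith)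
  · rw [eLaplacian_coord_mul_norm_rpow i _ _ (hweight (4 - m) i) hx]
    ring
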